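/- arXiv:1311.4502 — 3 statements merged into one kernel-verified Lean document; each statement's English description precedes it below -/
import Mathlib

section
/- Let ℓ be a nonnegative integer and let A, B : {0,1,…,ℓ} × ℕ → ℂ be two arrays of complex numbers. For 0 ≤ i ≤ ℓ define φ_i(x;0) = 1 and φ_i(x;n) = ∏_{k=0}^{n−1} (A_{i,k} + x·B_{i,k}) for n ≥ 1, and define Φ(x;n) = ∏_{i=0}^{ℓ} φ_i(x; ⌊(i+n)/(ℓ+1)⌋). For k ∈ ℕ write k = (ℓ+1)q + r with 0 ≤ r ≤ ℓ and set λ(k) = A_{ℓ−r, q} + k·B_{ℓ−r, q}. Assume Φ(x;n) ≠ 0 for all nonnegative integers x and n. Then for any two sequences F, G : ℕ → ℂ the following are equivalent: (i) for all n ∈ ℕ, F(n) = Σ_{k=0}^{n} (−1)^k C(n,k) Φ(k;n) G(k); (ii) for all n ∈ ℕ, G(n) = Σ_{k=0}^{n} (−1)^k C(n,k) (λ(k)/Φ(n;k+1)) F(k). (Multiplicate form of the Gould–Hsu inverse series relations.) -/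
open Finset in
theorem gh_diff (d e : ℕ) (h : e < d) (a b : ℕ → ℂ) (y : ℕ) :
    ∑ m ∈ range (d + 1), (-1 : ℂ) ^ m * (d.choose m : ℂ) *
      ∏ i ∈ range e, (a i + ((y + m : ℕ) : ℂ) * b i) = 0 := by
  set P : Polynomial ℂ := ∏ i ∈ range e, (Polynomial.C (a i) + Polynomial.X * Polynomial.C (b i))
    with hP
  have hdeg : P.natDegree < d := by
    refine lt_of_le_of_lt (Polynomial.natDegree_prod_le _ _) ?_
    refine lt_of_le_of_lt (Finset.sum_le_card_nsmul _ _ 1 ?_) (by simpa using h)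
    intro i _
    compute_degree
  have h0 := congrFun (Polynomial.fwdDiff_iter_eq_zero_of_degree_lt hdeg) (y : ℂ)
  rw [fwdDiff_iter_eq_sum_shift] at h0
  have h1 : ∀ m ∈ range (d + 1), (-1 : ℂ) ^ m * (d.choose m : ℂ) *
      ∏ i ∈ range e, (a i + ((y + m : ℕ) : ℂ) * b i) = (-1 : ℂ) ^ d *
      (((-1 : ℤ) ^ (d - m) * (d.choose m : ℤ)) • P.eval ((y : ℂ) + m • (1 : ℂ))) := by
    intro m hm
    have hm' : m ≤ d := by simpa [Nat.lt_succ_iff] using hm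
    obtain ⟨t, rfl⟩ := Nat.exists_eq_add_of_le hm'
    have h2 : (-1 : ℂ) ^ t * (-1 : ℂ) ^ t = 1 := by
      rw [← mul_pow]; simp
    simp only [hP, Polynomial.eval_prod, Polynomial.eval_add, Polynomial.eval_mul,
      Polynomial.eval_C, Polynomial.eval_X, zsmul_eq_mul, nsmul_eq_mul, mul_one,
      Nat.add_sub_cancel_left]
    push_cast
    rw [pow_add]
    linear_combination (-(-1 : ℂ) ^ m * ((m + t).choose m : ℂ) *
      ∏ i ∈ range e, (a i + ((y : ℂ) + m) * b i)) * h2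
  rw [Finset.sum_congr rfl h1, ← Finset.mul_sum, h0]
  simp

open Finset in
theorem gh_orth (a b : ℕ → ℂ) (Φ : ℕ → ℕ → ℂ)
    (hΦ : ∀ x n : ℕ, Φ x n = ∏ i ∈ range n, (a i + (x : ℂ) * b i))
    (hne : ∀ x n : ℕ, Φ x n ≠ 0) (n j : ℕ) :
    ∑ k ∈ range (n + 1), ((-1 : ℂ) ^ k * (n.choose k : ℂ) * Φ k n) *
      ((-1 : ℂ) ^ j * (k.choose j : ℂ) * ((a j + j * b j) / Φ k (j + 1)))
      = if j = n then 1 else 0 := by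
  rcases lt_trichotomy n j with h | rfl | h
  · rw [if_neg h.ne']
    refine sum_eq_zero fun k hk => ?_
    rw [Nat.choose_eq_zero_of_lt (n := k) (k := j) (by simp at hk; omega)]
    simp
  · rw [if_pos rfl, sum_range_succ, sum_eq_zero, zero_add]
    · have h1 := hne n n
      have h2 := hne n (n + 1)
      have h3 : Φ n (n + 1) = Φ n n * (a n + n * b n) := by
        rw [hΦ, hΦ, prod_range_succ]
      have h4 : (-1 : ℂ) ^ n * (-1 : ℂ) ^ n = 1 := by
        rw [← mul_pow]; simp
      rw [Nat.choose_self]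
      field_simp
      rw [h3]
      linear_combination (Φ n n * (a n + n * b n)) * h4
    · intro k hk
      rw [Nat.choose_eq_zero_of_lt (n := k) (k := n) (by simpa using hk)]
      simp
  · rw [if_neg h.ne]
    obtain ⟨e, rfl⟩ := Nat.exists_eq_add_of_lt h
    have hr : j + e + 1 + 1 = j + (e + 1 + 1) := by ring
    rw [hr, sum_range_add, sum_eq_zero, zero_add]
    · have hd := gh_diff (e + 1) e (by omega) (fun i => a (j + 1 + i)) (fun i => b (j + 1 + i)) j
      rw [← mul_zero (((j + e + 1).choose j : ℂ) * (a j + j * b j)), ← hd, mul_sum]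
      refine sum_congr rfl fun m _ => ?_
      have h1 : Φ (j + m) (j + e + 1) = Φ (j + m) (j + 1) *
          ∏ i ∈ range e, (a (j + 1 + i) + ((j + m : ℕ) : ℂ) * b (j + 1 + i)) := by
        rw [show j + e + 1 = (j + 1) + e by ring, hΦ, hΦ, prod_range_add]
      have h2 := hne (j + m) (j + 1)
      have h4 : (-1 : ℂ) ^ j * (-1 : ℂ) ^ j = 1 := by
        rw [← mul_pow]; simp
      have h5 : ((j + e + 1).choose (j + m) : ℂ) * ((j + m).choose j : ℂ)
          = ((j + e + 1).choose j : ℂ) * ((e + 1).choose m : ℂ) := by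
        have := Nat.choose_mul (n := j + e + 1) (k := j + m) (s := j) (by omega)
        rw [show j + e + 1 - j = e + 1 by omega, show j + m - j = m by omega] at this
        exact_mod_cast this
      rw [h1]
      set Q := ∏ i ∈ range e, (a (j + 1 + i) + ((j + m : ℕ) : ℂ) * b (j + 1 + i))
      have h6 : Φ (j + m) (j + 1) * Q * ((a j + j * b j) / Φ (j + m) (j + 1))
          = Q * (a j + j * b j) := by field_simp
      calc _ = ((-1 : ℂ) ^ j * (-1 : ℂ) ^ j) * (-1 : ℂ) ^ m *
            (((j + e + 1).choose (j + m) : ℂ) * ((j + m).choose j : ℂ)) *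
            (Φ (j + m) (j + 1) * Q * ((a j + j * b j) / Φ (j + m) (j + 1))) := by
            rw [pow_add]; ring
        _ = _ := by rw [h4, h5, h6]; ring
    · intro k hk
      rw [Nat.choose_eq_zero_of_lt (n := k) (k := j) (by simpa using hk)]
      simp

open Finset in
theorem gh_ii_i (a b : ℕ → ℂ) (Φ : ℕ → ℕ → ℂ)
    (hΦ : ∀ x n : ℕ, Φ x n = ∏ i ∈ range n, (a i + (x : ℂ) * b i))
    (hne : ∀ x n : ℕ, Φ x n ≠ 0) (F G : ℕ → ℂ)
    (h : ∀ n : ℕ, G n = ∑ k ∈ range (n + 1),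
        (-1 : ℂ) ^ k * (n.choose k : ℂ) * ((a k + k * b k) / Φ n (k + 1)) * F k) (n : ℕ) :
    F n = ∑ k ∈ range (n + 1), (-1 : ℂ) ^ k * (n.choose k : ℂ) * Φ k n * G k := by
  have h1 : ∀ k ∈ range (n + 1), G k = ∑ j ∈ range (n + 1),
        (-1 : ℂ) ^ j * (k.choose j : ℂ) * ((a j + j * b j) / Φ k (j + 1)) * F j := by
    intro k hk
    rw [h k]
    refine sum_subset (by simpa [Nat.lt_succ_iff] using hk) fun j _ hj => ?_
    rw [Nat.choose_eq_zero_of_lt (n := k) (k := j) (by simp at hj; omega)]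
    simp
  symm
  calc _ = ∑ k ∈ range (n + 1), ∑ j ∈ range (n + 1),
        (((-1 : ℂ) ^ k * (n.choose k : ℂ) * Φ k n) *
      ((-1 : ℂ) ^ j * (k.choose j : ℂ) * ((a j + j * b j) / Φ k (j + 1)))) * F j := by
        refine sum_congr rfl fun k hk => ?_
        rw [h1 k hk, mul_sum]
        refine sum_congr rfl fun j _ => ?_
        ring
    _ = ∑ j ∈ range (n + 1), (if j = n then 1 else 0) * F j := by
        rw [sum_comm]
        refine sum_congr rfl fun j _ => ?_
        rw [← sum_mul, gh_orth a b Φ hΦ hne]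
    _ = F n := by simp

theorem gh_step (ℓ n i : ℕ) (hi : i < ℓ + 1) :
    (i + (n + 1)) / (ℓ + 1) = (i + n) / (ℓ + 1) + (if i = ℓ - n % (ℓ + 1) then 1 else 0) ∧
    (i = ℓ - n % (ℓ + 1) → (i + n) / (ℓ + 1) = n / (ℓ + 1)) := by
  have hr : n % (ℓ + 1) < ℓ + 1 := Nat.mod_lt _ (by omega)
  have hn := Nat.div_add_mod n (ℓ + 1)
  set r := n % (ℓ + 1)
  set q := n / (ℓ + 1)
  have key : ∀ s c : ℕ, s < ℓ + 1 → ((ℓ + 1) * c + s) / (ℓ + 1) = c := by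
    intro s c hs
    rw [Nat.mul_add_div (by omega), Nat.div_eq_of_lt hs, add_zero]
  have hq : (ℓ + 1) * (q + 1) = (ℓ + 1) * q + (ℓ + 1) := by ring
  rcases lt_trichotomy i (ℓ - r) with h | h | h
  · rw [if_neg (by omega), show i + (n + 1) = (ℓ + 1) * q + (i + r + 1) by omega,
      show i + n = (ℓ + 1) * q + (i + r) by omega, key _ _ (by omega), key _ _ (by omega)]
    exact ⟨rfl, fun _ => rfl⟩
  · rw [if_pos h, show i + (n + 1) = (ℓ + 1) * (q + 1) + 0 by omega,
      show i + n = (ℓ + 1) * q + (i + r) by omega, key _ _ (by omega), key _ _ (by omega)]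
    exact ⟨rfl, fun _ => rfl⟩
  · rw [if_neg (by omega), show i + (n + 1) = (ℓ + 1) * (q + 1) + (i + r + 1 - (ℓ + 1)) by omega,
      show i + n = (ℓ + 1) * (q + 1) + (i + r - (ℓ + 1)) by omega,
      key _ _ (by omega), key _ _ (by omega)]
    exact ⟨rfl, fun h' => by omega⟩

open Finset in
theorem gh_prod (ℓ : ℕ) (f : ℕ → ℕ → ℂ) (n : ℕ) :
    ∏ i ∈ range (ℓ + 1), ∏ k ∈ range ((i + n) / (ℓ + 1)), f i k =
      ∏ j ∈ range n, f (ℓ - j % (ℓ + 1)) (j / (ℓ + 1)) := by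
  induction n with
  | zero =>
    refine prod_eq_one fun i hi => ?_
    rw [Nat.div_eq_of_lt (by simpa using hi)]
    simp
  | succ n ih =>
    rw [prod_range_succ (fun j => f (ℓ - j % (ℓ + 1)) (j / (ℓ + 1))), ← ih]
    have : ∀ i ∈ range (ℓ + 1), ∏ k ∈ range ((i + (n + 1)) / (ℓ + 1)), f i k =
        (∏ k ∈ range ((i + n) / (ℓ + 1)), f i k) *
          (if i = ℓ - n % (ℓ + 1) then f i (n / (ℓ + 1)) else 1) := by
      intro i hi
      obtain ⟨h1, h2⟩ := gh_step ℓ n i (by simpa using hi)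
      rw [h1]
      split_ifs with h
      · rw [prod_range_succ, h2 h]
      · simp
    rw [prod_congr rfl this, prod_mul_distrib, prod_ite_eq' (range (ℓ + 1)),
      if_pos (by simp)]

/-- Multiplicate form of the Gould–Hsu inverse series relations. -/
theorem multiplicate_gould_hsu_inverse
    (ℓ : ℕ) (A B : ℕ → ℕ → ℂ)
    (Φ : ℕ → ℕ → ℂ)
    (hΦ : ∀ x n : ℕ, Φ x n =
      ∏ i ∈ Finset.range (ℓ + 1), ∏ k ∈ Finset.range ((i + n) / (ℓ + 1)),
        (A i k + (x : ℂ) * B i k))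
    (lam : ℕ → ℂ)
    (hlam : ∀ k : ℕ, lam k =
      A (ℓ - k % (ℓ + 1)) (k / (ℓ + 1)) + (k : ℂ) * B (ℓ - k % (ℓ + 1)) (k / (ℓ + 1)))
    (hne : ∀ x n : ℕ, Φ x n ≠ 0)
    (F G : ℕ → ℂ) :
    (∀ n : ℕ, F n = ∑ k ∈ Finset.range (n + 1),
        (-1 : ℂ) ^ k * (n.choose k : ℂ) * Φ k n * G k) ↔
    (∀ n : ℕ, G n = ∑ k ∈ Finset.range (n + 1),
        (-1 : ℂ) ^ k * (n.choose k : ℂ) * (lam k / Φ n (k + 1)) * F k) := by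
  set a : ℕ → ℂ := fun k => A (ℓ - k % (ℓ + 1)) (k / (ℓ + 1)) with ha
  set b : ℕ → ℂ := fun k => B (ℓ - k % (ℓ + 1)) (k / (ℓ + 1)) with hb
  have hΦ' : ∀ x n : ℕ, Φ x n = ∏ i ∈ Finset.range n, (a i + (x : ℂ) * b i) := by
    intro x n
    rw [hΦ, gh_prod ℓ (fun i k => A i k + (x : ℂ) * B i k)]
  have hlam' : ∀ k, lam k = a k + k * b k := hlam
  simp only [hlam']
  constructor
  · intro h
    obtain ⟨G', hG'⟩ : ∃ G' : ℕ → ℂ, ∀ n : ℕ, G' n = ∑ k ∈ Finset.range (n + 1),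
        (-1 : ℂ) ^ k * (n.choose k : ℂ) * ((a k + k * b k) / Φ n (k + 1)) * F k :=
      ⟨_, fun n => rfl⟩
    have h2 := gh_ii_i a b Φ hΦ' hne F G' hG'
    intro n
    rw [← hG']
    induction n using Nat.strong_induction_on with
    | _ n ih =>
      have e1 := h n
      have e0 : ∑ k ∈ Finset.range n, (-1 : ℂ) ^ k * (n.choose k : ℂ) * Φ k n * G k =
          ∑ k ∈ Finset.range n, (-1 : ℂ) ^ k * (n.choose k : ℂ) * Φ k n * G' k :=
        Finset.sum_congr rfl (fun k hk => by rw [ih k (Finset.mem_range.mp hk)])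
      rw [h2 n, Finset.sum_range_succ, Finset.sum_range_succ, e0] at e1
      have e2 := add_left_cancel e1
      refine (mul_left_cancel₀ ?_ e2).symm
      simp [hne]
  · exact fun h => gh_ii_i a b Φ hΦ' hne F G h
end

section
/- Let (a_k), (b_k), (c_k), (d_k) (k ≥ 0) be four sequences of complex numbers and define φ(x;0) = 1, φ(x;n) = ∏_{k=0}^{n−1}(a_k + x·b_k) and ψ(x;0) = 1, ψ(x;n) = ∏_{k=0}^{n−1}(c_k + x·d_k) for n ≥ 1. Assume φ(x;n) ≠ 0 and ψ(x;n) ≠ 0 for all nonnegative integers x and n. Then for any sequences F, G : ℕ → ℂ the following are equivalent: (i) for all n ∈ ℕ, F(n) = Σ_{k=0}^{n} (−1)^k C(n,k) φ(k;⌊n/2⌋) ψ(k;⌊(n+1)/2⌋) G(k); (ii) for all n ∈ ℕ, G(n) = Σ_{0 ≤ 2k ≤ n} C(n,2k) (c_k + 2k·d_k)/(φ(n;k) ψ(n;k+1)) · F(2k) − Σ_{0 ≤ 2k+1 ≤ n} C(n,2k+1) (a_k + (2k+1)·b_k)/(φ(n;k+1) ψ(n;k+1)) · F(2k+1). (Duplicate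 form of the Gould–Hsu inverse series relations.) -/
open Finset in
lemma gh_alt_sum (P : Polynomial ℂ) (n : ℕ) (hP : P.natDegree < n) :
    ∑ k ∈ range (n + 1), (-1 : ℂ) ^ k * (n.choose k : ℂ) * P.eval (k : ℂ) = 0 := by
  have h := congrFun (Polynomial.fwdDiff_iter_eq_zero_of_degree_lt hP) 0
  rw [fwdDiff_iter_eq_sum_shift] at h
  have h2 : ∑ k ∈ range (n + 1), (-1 : ℂ) ^ k * (n.choose k : ℂ) * P.eval (k : ℂ)
      = (-1) ^ n * ∑ k ∈ range (n + 1),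
        ((-1 : ℤ) ^ (n - k) * n.choose k) • P.eval ((0 : ℂ) + k • (1 : ℂ)) := by
    rw [mul_sum]
    refine sum_congr rfl fun k hk => ?_
    have hk' : k ≤ n := by simpa [Nat.lt_succ_iff] using hk
    obtain ⟨m, rfl⟩ := Nat.exists_eq_add_of_le hk'
    have h1 : ((-1 : ℂ) ^ m) * (-1) ^ m = 1 := by
      rw [← mul_pow]; simp
    simp only [zsmul_eq_mul, nsmul_eq_mul, mul_one, zero_add, Nat.add_sub_cancel_left, pow_add]
    push_cast
    linear_combination (-(-1 : ℂ) ^ k * ((k + m).choose k : ℂ) * P.eval (k : ℂ)) * h1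
  rw [h2, h]; simp

open Finset in
lemma gh_sum_choose (A B : ℕ → ℂ) (n j : ℕ) (hj : j < n) :
    ∑ k ∈ range (n + 1), (-1 : ℂ) ^ k * (n.choose k : ℂ) *
      ((k.choose j : ℂ) * ∏ i ∈ Ico (j + 1) n, (A i + (k : ℂ) * B i)) = 0 := by
  let Q : Polynomial ℂ := ∏ i ∈ Ico (j + 1) n, (Polynomial.C (A i) + Polynomial.X * Polynomial.C (B i))
  have hQ : Q.natDegree ≤ n - (j + 1) := by
    refine (Polynomial.natDegree_prod_le _ _).trans ?_
    refine (sum_le_card_nsmul _ _ 1 fun i _ => ?_).trans (by simp)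
    compute_degree
  have hd : (descPochhammer ℂ j).natDegree = j := descPochhammer_natDegree ℂ j
  have hdeg : (descPochhammer ℂ j * Q).natDegree < n := by
    have := Polynomial.natDegree_mul_le (p := descPochhammer ℂ j) (q := Q)
    omega
  have h := gh_alt_sum _ n hdeg
  have hf : (j.factorial : ℂ) ≠ 0 := by exact_mod_cast j.factorial_ne_zero
  apply mul_left_cancel₀ hf
  rw [mul_zero, ← h, mul_sum]
  refine sum_congr rfl fun k _ => ?_
  rw [Polynomial.eval_mul, descPochhammer_eval_eq_descFactorial,
    Nat.descFactorial_eq_factorial_mul_choose]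
  simp only [Q, Polynomial.eval_prod, Polynomial.eval_add, Polynomial.eval_mul,
    Polynomial.eval_C, Polynomial.eval_X]
  push_cast
  ring

open Finset in
lemma gh_backward (A B : ℕ → ℂ) (Φ : ℕ → ℕ → ℂ)
    (hΦ : ∀ x n : ℕ, Φ x n = ∏ k ∈ range n, (A k + (x : ℂ) * B k))
    (hne : ∀ x n, Φ x n ≠ 0) (F G : ℕ → ℂ)
    (hG : ∀ n, G n = ∑ k ∈ range (n + 1),
      (-1 : ℂ) ^ k * (n.choose k : ℂ) * ((A k + (k : ℂ) * B k) / Φ n (k + 1)) * F k) (n : ℕ) :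
    F n = ∑ k ∈ range (n + 1), (-1 : ℂ) ^ k * (n.choose k : ℂ) * Φ k n * G k := by
  have hext : ∀ k ∈ range (n + 1), G k = ∑ j ∈ range (n + 1),
      (-1 : ℂ) ^ j * (k.choose j : ℂ) * ((A j + (j : ℂ) * B j) / Φ k (j + 1)) * F j := by
    intro k hk
    rw [hG k]
    refine sum_subset (range_mono (by simpa using hk)) fun j _ hj => ?_
    rw [Nat.choose_eq_zero_of_lt (by simpa using hj)]
    simp
  rw [sum_congr rfl fun k hk => by rw [hext k hk]]
  simp_rw [mul_sum]
  rw [sum_comm, sum_range_succ]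
  have hz : ∀ j ∈ range n, ∑ k ∈ range (n + 1), (-1 : ℂ) ^ k * (n.choose k : ℂ) * Φ k n *
      ((-1 : ℂ) ^ j * (k.choose j : ℂ) * ((A j + (j : ℂ) * B j) / Φ k (j + 1)) * F j) = 0 := by
    intro j hj
    have hj' : j < n := by simpa using hj
    rw [← mul_zero ((-1 : ℂ) ^ j * (A j + (j : ℂ) * B j) * F j), ← gh_sum_choose A B n j hj', mul_sum]
    refine sum_congr rfl fun k _ => ?_
    have hs : Φ k n = Φ k (j + 1) * ∏ i ∈ Ico (j + 1) n, (A i + (k : ℂ) * B i) := by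
      rw [hΦ, hΦ, prod_range_mul_prod_Ico _ (by omega)]
    have := hne k (j + 1)
    rw [hs]
    field_simp
  rw [sum_eq_zero hz, zero_add, sum_range_succ, sum_eq_zero, zero_add]
  · have h1 : Φ n (n + 1) = Φ n n * (A n + (n : ℂ) * B n) := by
      rw [hΦ, hΦ, prod_range_succ]
    have h2 := hne n (n + 1)
    have h4 : ((-1 : ℂ) ^ n) * (-1) ^ n = 1 := by
      rw [← mul_pow]; simp
    have h5 : Φ n n * ((A n + (n : ℂ) * B n) / Φ n (n + 1)) = 1 := by
      rw [← mul_div_assoc, ← h1, div_self h2]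
    simp only [Nat.choose_self, Nat.cast_one, mul_one]
    linear_combination (-F n) * h4 - ((-1 : ℂ) ^ n * (-1) ^ n * F n) * h5
  · intro k hk
    rw [Nat.choose_eq_zero_of_lt (show k < n by simpa using hk)]
    simp

open Finset in
lemma gh_iff (A B : ℕ → ℂ) (Φ : ℕ → ℕ → ℂ)
    (hΦ : ∀ x n : ℕ, Φ x n = ∏ k ∈ range n, (A k + (x : ℂ) * B k))
    (hne : ∀ x n, Φ x n ≠ 0) (F G : ℕ → ℂ) :
    (∀ n, F n = ∑ k ∈ range (n + 1), (-1 : ℂ) ^ k * (n.choose k : ℂ) * Φ k n * G k) ↔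
    (∀ n, G n = ∑ k ∈ range (n + 1),
      (-1 : ℂ) ^ k * (n.choose k : ℂ) * ((A k + (k : ℂ) * B k) / Φ n (k + 1)) * F k) := by
  refine ⟨fun hF => ?_, gh_backward A B Φ hΦ hne F G⟩
  let G' : ℕ → ℂ := fun n => ∑ k ∈ range (n + 1),
      (-1 : ℂ) ^ k * (n.choose k : ℂ) * ((A k + (k : ℂ) * B k) / Φ n (k + 1)) * F k
  have hF' := gh_backward A B Φ hΦ hne F G' (fun _ => rfl)
  intro n
  change G n = G' n
  induction n using Nat.strong_induction_on with
  | _ n ih =>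
    have h := (hF n).symm.trans (hF' n)
    rw [sum_range_succ, sum_range_succ, sum_congr rfl fun k hk => by
      rw [ih k (by simpa using hk)]] at h
    have h := add_left_cancel h
    refine mul_left_cancel₀ ?_ h
    simp [hne]

open Finset in
lemma gh_split (f : ℕ → ℂ) (n : ℕ) :
    ∑ k ∈ range n, f k =
      ∑ k ∈ range ((n + 1) / 2), f (2 * k) + ∑ k ∈ range (n / 2), f (2 * k + 1) := by
  induction n with
  | zero => simp
  | succ n ih =>
    rw [sum_range_succ, ih]
    rcases Nat.even_or_odd' n with ⟨m, rfl | rfl⟩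
    · rw [show (2 * m + 1 + 1) / 2 = m + 1 by omega, show (2 * m + 1) / 2 = m by omega,
        show 2 * m / 2 = m by omega, sum_range_succ]
      ring
    · rw [show (2 * m + 1 + 1 + 1) / 2 = m + 1 by omega, show (2 * m + 1 + 1) / 2 = m + 1 by omega,
        show (2 * m + 1) / 2 = m by omega, sum_range_succ _ m, sum_range_succ _ m]
      ring

/-- Duplicate form of the Gould–Hsu inverse series relations. -/
theorem duplicate_gould_hsu_inverse
    (a b c d : ℕ → ℂ)
    (φ ψ : ℕ → ℕ → ℂ)
    (hφ : ∀ x n : ℕ, φ x n = ∏ k ∈ Finset.range n, (a k + (x : ℂ) * b k))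
    (hψ : ∀ x n : ℕ, ψ x n = ∏ k ∈ Finset.range n, (c k + (x : ℂ) * d k))
    (hφne : ∀ x n : ℕ, φ x n ≠ 0)
    (hψne : ∀ x n : ℕ, ψ x n ≠ 0)
    (F G : ℕ → ℂ) :
    (∀ n : ℕ, F n = ∑ k ∈ Finset.range (n + 1),
        (-1 : ℂ) ^ k * (n.choose k : ℂ) * φ k (n / 2) * ψ k ((n + 1) / 2) * G k) ↔
    (∀ n : ℕ, G n =
      (∑ k ∈ Finset.range (n / 2 + 1),
        (n.choose (2 * k) : ℂ) * ((c k + 2 * (k : ℂ) * d k) / (φ n k * ψ n (k + 1))) * F (2 * k)) -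
      ∑ k ∈ Finset.range ((n + 1) / 2),
        (n.choose (2 * k + 1) : ℂ) *
          ((a k + (2 * (k : ℂ) + 1) * b k) / (φ n (k + 1) * ψ n (k + 1))) * F (2 * k + 1)) := by
  let A : ℕ → ℂ := fun j => if j % 2 = 0 then c (j / 2) else a (j / 2)
  let B : ℕ → ℂ := fun j => if j % 2 = 0 then d (j / 2) else b (j / 2)
  have hA0 : ∀ k, A (2 * k) = c k := fun k => by simp [A]
  have hB0 : ∀ k, B (2 * k) = d k := fun k => by simp [B]
  have hA1 : ∀ k, A (2 * k + 1) = a k := fun k => by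
    simp [A, show (2 * k + 1) / 2 = k by omega, show (2 * k + 1) % 2 = 1 by omega]
  have hB1 : ∀ k, B (2 * k + 1) = b k := fun k => by
    simp [B, show (2 * k + 1) / 2 = k by omega, show (2 * k + 1) % 2 = 1 by omega]
  let Φ : ℕ → ℕ → ℂ := fun x n => φ x (n / 2) * ψ x ((n + 1) / 2)
  have hΦ : ∀ x n : ℕ, Φ x n = ∏ k ∈ Finset.range n, (A k + (x : ℂ) * B k) := by
    intro x n
    induction n with
    | zero => simp [Φ, hφ, hψ]
    | succ n ih =>
      rw [Finset.prod_range_succ, ← ih]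
      rcases Nat.even_or_odd' n with ⟨m, rfl | rfl⟩
      · simp only [Φ, hA0, hB0]
        rw [show (2 * m + 1 + 1) / 2 = m + 1 by omega, show (2 * m + 1) / 2 = m by omega,
          show 2 * m / 2 = m by omega, hψ x (m + 1), hψ x m, Finset.prod_range_succ]
        ring
      · simp only [Φ, hA1, hB1]
        rw [show (2 * m + 1 + 1 + 1) / 2 = m + 1 by omega,
          show (2 * m + 1 + 1) / 2 = m + 1 by omega,
          show (2 * m + 1) / 2 = m by omega, hφ x (m + 1), hφ x m, Finset.prod_range_succ]
        ring
  have hne : ∀ x n, Φ x n ≠ 0 := fun x n => mul_ne_zero (hφne _ _) (hψne _ _)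
  have key := gh_iff A B Φ hΦ hne F G
  have e1 : ∀ n : ℕ, (∑ k ∈ Finset.range (n + 1),
        (-1 : ℂ) ^ k * (n.choose k : ℂ) * φ k (n / 2) * ψ k ((n + 1) / 2) * G k) =
      ∑ k ∈ Finset.range (n + 1), (-1 : ℂ) ^ k * (n.choose k : ℂ) * Φ k n * G k := by
    intro n
    refine Finset.sum_congr rfl fun k _ => ?_
    simp only [Φ]
    ring
  have e2 : ∀ n : ℕ, ((∑ k ∈ Finset.range (n / 2 + 1),
        (n.choose (2 * k) : ℂ) * ((c k + 2 * (k : ℂ) * d k) / (φ n k * ψ n (k + 1))) * F (2 * k)) -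
      ∑ k ∈ Finset.range ((n + 1) / 2),
        (n.choose (2 * k + 1) : ℂ) *
          ((a k + (2 * (k : ℂ) + 1) * b k) / (φ n (k + 1) * ψ n (k + 1))) * F (2 * k + 1)) =
      ∑ k ∈ Finset.range (n + 1),
        (-1 : ℂ) ^ k * (n.choose k : ℂ) * ((A k + (k : ℂ) * B k) / Φ n (k + 1)) * F k := by
    intro n
    rw [gh_split _ (n + 1), show (n + 1 + 1) / 2 = n / 2 + 1 by omega, sub_eq_add_neg,
      ← Finset.sum_neg_distrib]
    congr 1
    · refine Finset.sum_congr rfl fun k _ => ?_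
      simp only [Φ, hA0, hB0]
      rw [show (2 * k + 1 + 1) / 2 = k + 1 by omega, show (2 * k + 1) / 2 = k by omega, pow_mul]
      push_cast
      simp
    · refine Finset.sum_congr rfl fun k _ => ?_
      simp only [Φ, hA1, hB1]
      rw [show (2 * k + 1 + 1 + 1) / 2 = k + 1 by omega,
        show (2 * k + 1 + 1) / 2 = k + 1 by omega, pow_succ, pow_mul]
      push_cast
      simp
  simp only [e1, e2]
  exact key
end

section
/- Let n be a nonnegative integer and let a, c ∈ ℂ satisfy c + j ≠ 0 for 0 ≤ j ≤ n−1 and 1−c−n+j ≠ 0 for 0 ≤ j ≤ ⌊n/2⌋. Then (c−a)_n/(c)_n = Σ_{k=0}^{⌊n/2⌋} C(n,2k) (1−a)_k (a)_k / ((1−c−n)_k (c)_k) + Σ_{0 ≤ 2k+1 ≤ n} C(n,2k+1) (c+k) (1−a)_k (a)_{k+1} / ((1−c−n)_{k+1} (c)_{k+1}). (First reciprocal relation dual to the Chu–Vandermonde–Gauß summation formula.) -/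
/-- Rising factorial (Pochhammer symbol) of a complex number:
`poch x 0 = 1` and `poch x (m+1) = poch x m * (x + m)`. -/
noncomputable def poch (x : ℂ) : ℕ → ℂ
  | 0 => 1
  | m + 1 => poch x m * (x + (m : ℂ))

lemma poch_succ_left (x : ℂ) (m : ℕ) : poch x (m + 1) = x * poch (x + 1) m := by
  induction m with
  | zero => simp [poch]
  | succ m ih =>
    rw [poch, ih, poch]
    push_cast
    ring

lemma poch_nabla (x : ℂ) (m : ℕ) :
    poch x (m + 1) - poch (x - 1) (m + 1) = (m + 1) * poch x m := by
  rw [poch_succ_left (x - 1), poch, sub_add_cancel]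
  ring

lemma poch_add (x : ℂ) (m k : ℕ) : poch x (m + k) = poch x m * poch (x + m) k := by
  induction k with
  | zero => simp [poch]
  | succ k ih =>
    rw [← add_assoc, poch, ih, poch]
    push_cast
    ring

lemma poch_neg_nat (i m : ℕ) (h : i < m) : poch (-(i : ℂ)) m = 0 := by
  obtain ⟨d, rfl⟩ := Nat.exists_eq_add_of_lt h
  rw [show i + d + 1 = (i + 1) + d by omega, poch_add, poch]
  simp

/-- Functions given by a polynomial. -/
def IsPolyFun (f : ℂ → ℂ) : Prop := ∃ p : Polynomial ℂ, ∀ x, f x = p.eval x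

lemma IsPolyFun.mul {f g : ℂ → ℂ} (hf : IsPolyFun f) (hg : IsPolyFun g) :
    IsPolyFun (fun x => f x * g x) := by
  obtain ⟨p, hp⟩ := hf
  obtain ⟨q, hq⟩ := hg
  exact ⟨p * q, fun x => by simp [hp, hq]⟩

lemma IsPolyFun.sub {f g : ℂ → ℂ} (hf : IsPolyFun f) (hg : IsPolyFun g) :
    IsPolyFun (fun x => f x - g x) := by
  obtain ⟨p, hp⟩ := hf
  obtain ⟨q, hq⟩ := hg
  exact ⟨p - q, fun x => by simp [hp, hq]⟩

lemma IsPolyFun.const (b : ℂ) : IsPolyFun (fun _ => b) :=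
  ⟨Polynomial.C b, fun x => by simp⟩

lemma IsPolyFun.sum (s : Finset ℕ) (f : ℕ → ℂ → ℂ) (hf : ∀ j, IsPolyFun (f j)) :
    IsPolyFun (fun x => ∑ j ∈ s, f j x) := by
  choose p hp using hf
  exact ⟨∑ j ∈ s, p j, fun x => by simp [hp, Polynomial.eval_finsetSum]⟩

lemma IsPolyFun.poch (b : ℂ) (m : ℕ) : IsPolyFun (fun x => poch (b + x) m) := by
  induction m with
  | zero => exact IsPolyFun.const 1
  | succ m ih =>
    exact ih.mul ⟨Polynomial.C b + Polynomial.X + Polynomial.C (m : ℂ), fun x => by simp⟩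

lemma IsPolyFun.poch_sub (b : ℂ) (m : ℕ) : IsPolyFun (fun x => _root_.poch (x - b) m) := by
  have := IsPolyFun.poch (-b) m
  simpa only [neg_add_eq_sub] using this

lemma polyFun_eq {f g : ℂ → ℂ} (hf : IsPolyFun f) (hg : IsPolyFun g) (h0 : f 0 = g 0)
    (hs : ∀ x, f x - f (x - 1) = g x - g (x - 1)) (x : ℂ) : f x = g x := by
  have hn : ∀ n : ℕ, f n = g n := by
    intro n
    induction n with
    | zero => simpa using h0
    | succ n ih =>
      have := hs ((n + 1 : ℕ) : ℂ)
      rw [show ((n + 1 : ℕ) : ℂ) - 1 = n by push_cast; ring, ih] at this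
      exact sub_left_injective this
  obtain ⟨p, hp⟩ := hf
  obtain ⟨q, hq⟩ := hg
  have : p = q := by
    apply Polynomial.eq_of_infinite_eval_eq
    apply (Set.infinite_range_of_injective (Nat.cast_injective (R := ℂ))).mono
    rintro _ ⟨n, rfl⟩
    have := hn n
    rw [hp, hq] at this
    exact this
  rw [hp, hq, this]

lemma nabla_sum (n : ℕ) (u v : ℕ → ℂ) (x : ℂ) (w : ℕ → ℂ) :
    (∑ j ∈ Finset.range (n + 2), ((n + 1).choose j : ℂ) * poch (x - u j) j * w j) -
      (∑ j ∈ Finset.range (n + 2), ((n + 1).choose j : ℂ) * poch (x - 1 - u j) j * w j) =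
    (n + 1) * ∑ i ∈ Finset.range (n + 1), (n.choose i : ℂ) * poch (x - u (i + 1)) i * w (i + 1) := by
  rw [Finset.sum_range_succ' _ (n + 1), Finset.sum_range_succ' _ (n + 1)]
  simp only [poch]
  rw [add_sub_add_right_eq_sub, ← Finset.sum_sub_distrib, Finset.mul_sum]
  refine Finset.sum_congr rfl fun i _ => ?_
  have h := poch_nabla (x - u (i + 1)) i
  have hc : ((n + 1 : ℂ)) * (n.choose i : ℂ) = ((n + 1).choose (i + 1) : ℂ) * (i + 1) := by
    exact_mod_cast Nat.add_one_mul_choose_eq n i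
  simp only [poch] at h
  rw [show x - 1 - u (i + 1) = x - u (i + 1) - 1 by ring]
  linear_combination ((n + 1).choose (i + 1) : ℂ) * w (i + 1) * h
    - poch (x - u (i + 1)) i * w (i + 1) * hc

lemma key (n : ℕ) : ∀ c x : ℂ,
    (poch (c + x) n = ∑ j ∈ Finset.range (n + 1),
      (n.choose j : ℂ) * poch (x - ((j - 1) / 2 : ℕ)) j * poch (c + (j / 2 : ℕ)) (n - j)) ∧
    (poch (c + x) n = ∑ j ∈ Finset.range (n + 1),
      (n.choose j : ℂ) * poch (x - (j / 2 : ℕ)) j * poch (c + ((j + 1) / 2 : ℕ)) (n - j)) := by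
  induction n with
  | zero => intro c x; simp [poch]
  | succ n ih =>
    intro c x
    have hP : ∀ (u : ℕ → ℕ) (w : ℕ → ℂ), IsPolyFun (fun x => ∑ j ∈ Finset.range (n + 1 + 1),
      ((n + 1).choose j : ℂ) * poch (x - (u j : ℂ)) j * w j) := fun u w =>
      IsPolyFun.sum _ _ fun j => ((IsPolyFun.const _).mul (IsPolyFun.poch_sub _ _)).mul
        (IsPolyFun.const _)
    constructor
    · refine polyFun_eq (f := fun x => poch (c + x) (n + 1)) (IsPolyFun.poch c (n + 1))
        (hP (fun j => (j - 1) / 2) (fun j => poch (c + (j / 2 : ℕ)) (n + 1 - j))) ?_ ?_ x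
      · rw [Finset.sum_range_succ', Finset.sum_eq_zero]
        · simp [poch]
        · intro i _
          rw [zero_sub, poch_neg_nat _ _ (by omega)]
          simp
      · intro y
        rw [nabla_sum n (fun j => (((j - 1) / 2 : ℕ) : ℂ)) 0 y
          (fun j => poch (c + (j / 2 : ℕ)) (n + 1 - j)), ← add_sub_assoc, poch_nabla,
          (ih c y).2]
        congr 1
        refine Finset.sum_congr rfl fun i _ => ?_
        rw [Nat.add_sub_add_right n 1 i, Nat.add_sub_cancel]
    · refine polyFun_eq (f := fun x => poch (c + x) (n + 1)) (IsPolyFun.poch c (n + 1))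
        (hP (fun j => j / 2) (fun j => poch (c + ((j + 1) / 2 : ℕ)) (n + 1 - j))) ?_ ?_ x
      · rw [Finset.sum_range_succ', Finset.sum_eq_zero]
        · simp [poch]
        · intro i _
          rw [zero_sub, poch_neg_nat _ _ (by omega)]
          simp
      · intro y
        rw [nabla_sum n (fun j => ((j / 2 : ℕ) : ℂ)) 0 y
          (fun j => poch (c + ((j + 1) / 2 : ℕ)) (n + 1 - j)), ← add_sub_assoc, poch_nabla,
          show c + y = (c + 1) + (y - 1) by ring, (ih (c + 1) (y - 1)).1]
        congr 1
        refine Finset.sum_congr rfl fun i _ => ?_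
        rw [Nat.add_sub_add_right, show (i + 1 + 1) / 2 = i / 2 + 1 by omega]
        have e : c + 1 + ((i / 2 : ℕ) : ℂ) = c + ((i / 2 + 1 : ℕ) : ℂ) := by push_cast; ring
        rw [e]
        rcases Nat.eq_zero_or_pos i with rfl | hi
        · simp [poch]
        · have e2 : y - 1 - (((i - 1) / 2 : ℕ) : ℂ) = y - (((i + 1) / 2 : ℕ) : ℂ) := by
            rw [show (i + 1) / 2 = (i - 1) / 2 + 1 by omega]
            push_cast
            ring
          rw [e2]

lemma sum_parity (f : ℕ → ℂ) (n : ℕ) : ∑ j ∈ Finset.range (n + 1), f j =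
    ∑ k ∈ Finset.range (n / 2 + 1), f (2 * k) + ∑ k ∈ Finset.range ((n + 1) / 2), f (2 * k + 1) := by
  induction n with
  | zero => simp
  | succ n ih =>
    rw [Finset.sum_range_succ, ih]
    rcases Nat.even_or_odd' n with ⟨m, rfl | rfl⟩
    · rw [show (2 * m + 1) / 2 = m by omega, show 2 * m / 2 = m by omega,
        show (2 * m + 1 + 1) / 2 = m + 1 by omega, Finset.sum_range_succ _ m,
        Finset.sum_range_succ _ m]
      ring
    · rw [show (2 * m + 1) / 2 = m by omega, show (2 * m + 1 + 1 + 1) / 2 = m + 1 by omega,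
        show (2 * m + 1 + 1) / 2 = m + 1 by omega, Finset.sum_range_succ _ (m + 1)]
      rw [show 2 * m + 1 + 1 = 2 * (m + 1) by ring]
      ring

lemma poch_odd (a : ℂ) (k : ℕ) :
    poch (-a - k) (2 * k + 1) = (-1) ^ (k + 1) * (poch (1 - a) k * poch a (k + 1)) := by
  induction k with
  | zero => simp [poch]
  | succ k ih =>
    rw [show 2 * (k + 1) + 1 = (2 * k + 1 + 1) + 1 by ring, poch_succ_left,
      show -a - ((k + 1 : ℕ) : ℂ) + 1 = -a - k by push_cast; ring, poch, ih]
    simp only [poch]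
    push_cast
    ring

lemma poch_even (a : ℂ) (k : ℕ) :
    poch (-a - ((2 * k - 1) / 2 : ℕ)) (2 * k) = (-1) ^ k * (poch (1 - a) k * poch a k) := by
  cases k with
  | zero => simp [poch]
  | succ k =>
    rw [show (2 * (k + 1) - 1) / 2 = k by omega, show 2 * (k + 1) = 2 * k + 1 + 1 by ring, poch,
      poch_odd]
    simp only [poch]
    push_cast
    ring

lemma poch_reflect (c : ℂ) (n k : ℕ) (h : k ≤ n) :
    poch (1 - c - n) k * poch c (n - k) = (-1) ^ k * poch c n := by
  induction k with
  | zero => simp [poch]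
  | succ k ih =>
    have ih := ih (by omega)
    obtain ⟨d, rfl⟩ := Nat.exists_eq_add_of_le h
    rw [show k + 1 + d - k = d + 1 by omega, poch] at ih
    rw [show k + 1 + d - (k + 1) = d by omega, poch, pow_succ]
    push_cast at ih ⊢
    linear_combination -ih

lemma poch_ne (c : ℂ) (m : ℕ) (h : ∀ j : ℕ, j < m → c + (j : ℂ) ≠ 0) : poch c m ≠ 0 := by
  induction m with
  | zero => simp [poch]
  | succ m ih => exact mul_ne_zero (ih fun j hj => h j (by omega)) (h m (by omega))

/-- First reciprocal relation dual to the Chu–Vandermonde–Gauß summation formula. -/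
theorem cvg_reciprocal_first (n : ℕ) (a c : ℂ)
    (hc : ∀ j : ℕ, j < n → c + (j : ℂ) ≠ 0)
    (hcn : ∀ j : ℕ, j ≤ n / 2 → 1 - c - (n : ℂ) + (j : ℂ) ≠ 0) :
    poch (c - a) n / poch c n =
      (∑ k ∈ Finset.range (n / 2 + 1),
        (n.choose (2 * k) : ℂ) * (poch (1 - a) k * poch a k) /
          (poch (1 - c - (n : ℂ)) k * poch c k)) +
      ∑ k ∈ Finset.range ((n + 1) / 2),
        (n.choose (2 * k + 1) : ℂ) * ((c + (k : ℂ)) * poch (1 - a) k * poch a (k + 1)) /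
          (poch (1 - c - (n : ℂ)) (k + 1) * poch c (k + 1)) := by
  have hN := poch_ne c n hc
  have hD : ∀ k ≤ n, poch (1 - c - (n : ℂ)) k ≠ 0 := fun k hk h0 => by
    have := poch_reflect c n k hk
    rw [h0, zero_mul] at this
    exact mul_ne_zero (pow_ne_zero k (by norm_num)) hN this.symm
  rw [sub_eq_add_neg, (key n c (-a)).1, sum_parity, add_div, Finset.sum_div, Finset.sum_div]
  congr 1
  · refine Finset.sum_congr rfl fun k hk => ?_
    have hk : 2 * k ≤ n := by have := Finset.mem_range.1 hk; omega
    have hpk := poch_ne c k fun j hj => hc j (by omega)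
    have hr := poch_reflect c n k (by omega)
    rw [show n - k = k + (n - 2 * k) by omega, poch_add c k] at hr
    rw [poch_even, show 2 * k / 2 = k by omega,
      div_eq_div_iff hN (mul_ne_zero (hD k (by omega)) hpk)]
    have hs : ((-1 : ℂ) ^ k) * (-1) ^ k = 1 := by rw [← mul_pow]; simp
    linear_combination (n.choose (2 * k) : ℂ) * (poch (1 - a) k * poch a k) *
      ((-1) ^ k * hr + poch c n * hs)
  · refine Finset.sum_congr rfl fun k hk => ?_
    have hk : 2 * k + 1 ≤ n := by have := Finset.mem_range.1 hk; omega
    have hpk := poch_ne c (k + 1) fun j hj => hc j (by omega)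
    have hr := poch_reflect c n (k + 1) (by omega)
    rw [show n - (k + 1) = k + (n - (2 * k + 1)) by omega, poch_add c k] at hr
    rw [show (2 * k + 1 - 1) / 2 = k by omega, poch_odd, show (2 * k + 1) / 2 = k by omega,
      div_eq_div_iff hN (mul_ne_zero (hD (k + 1) (by omega)) hpk)]
    have hs : ((-1 : ℂ) ^ (k + 1)) * (-1) ^ (k + 1) = 1 := by rw [← mul_pow]; simp
    rw [show poch c (k + 1) = poch c k * (c + k) from rfl]
    linear_combination (n.choose (2 * k + 1) : ℂ) * (poch (1 - a) k * poch a (k + 1)) * (c + k) *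
      ((-1) ^ (k + 1) * hr + poch c n * hs)
end
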